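/- There exists a universal numeric constant c > 0 satisfying the following: for every n ≥ 1, every orthotope Ω in ℝⁿ, and all integers k ≥ l ≥ 1, there exists a convex partition {Ω_i}_{i=1}^{k'} of Ω with k' ≤ k such that every part satisfies Diam Ω_i ≤ c · n^(3/2) · (l/k)^(1/n) / √(μ_l(Ω)). -/

import Mathlib

open MeasureTheory

/-- The `k`-th Neumann eigenvalue of the Laplacian on `Ω ⊆ ℝⁿ`, defined via the
Courant–Fischer min-max principle: the infimum over `(k+1)`-dimensional spaces `V`
of test functions (smooth functions, distinguished by their restrictions to `Ω`)
of the supremum of the Rayleigh quotient `∫_Ω ‖∇f‖² / ∫_Ω f²` over nonzero `f ∈ V`. -/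
noncomputable def neumannEigenvalue (n : ℕ) (k : ℕ)
    (Ω : Set (EuclideanSpace ℝ (Fin n))) : ℝ :=
  ⨅ V : {V : Submodule ℝ (EuclideanSpace ℝ (Fin n) → ℝ) //
      Module.finrank ℝ V = k + 1 ∧ (∀ f ∈ V, ContDiff ℝ (⊤ : ℕ∞) f) ∧
      ∀ f ∈ V, (∀ x ∈ Ω, f x = 0) → f = 0},
    ⨆ f : {f : EuclideanSpace ℝ (Fin n) → ℝ // f ∈ V.1 ∧ f ≠ 0},
      (∫ x in Ω, ‖fderiv ℝ f.1 x‖ ^ 2) / ∫ x in Ω, (f.1 x) ^ 2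

/-- `Ω` is an orthotope in `ℝⁿ`: up to a rigid motion, it is a product
`∏ i, [-a i, a i]` with all `a i > 0`. -/
def IsOrthotope (n : ℕ) (Ω : Set (EuclideanSpace ℝ (Fin n))) : Prop :=
  ∃ (T : EuclideanSpace ℝ (Fin n) ≃ᵢ EuclideanSpace ℝ (Fin n)) (a : Fin n → ℝ),
    (∀ i, 0 < a i) ∧ Ω = T '' {x : EuclideanSpace ℝ (Fin n) | ∀ i, |x i| ≤ a i}

/-- `P` is a convex partition of `Ω`: finitely many convex pieces covering `Ω`
whose pairwise intersections have Lebesgue measure zero. -/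
def IsConvexPartition {n m : ℕ} (Ω : Set (EuclideanSpace ℝ (Fin n)))
    (P : Fin m → Set (EuclideanSpace ℝ (Fin n))) : Prop :=
  (∀ i, Convex ℝ (P i)) ∧ Ω = ⋃ i, P i ∧
    ∀ i j, i ≠ j → MeasureTheory.volume (P i ∩ P j) = 0


section Poincare
variable {n : ℕ}

lemma pw_bound (f : EuclideanSpace ℝ (Fin n) → ℝ) (hf : ContDiff ℝ 1 f)
    (x y : EuclideanSpace ℝ (Fin n)) (D : ℝ) (hD : ‖x - y‖ ≤ D) :
    ENNReal.ofReal ((f x - f y) ^ 2) ≤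
      ∫⁻ t in Set.Ioc (0:ℝ) 1, ENNReal.ofReal (D ^ 2) *
        ENNReal.ofReal (‖fderiv ℝ f ((1 - t) • y + t • x)‖ ^ 2) := by
  have hdf : Continuous (fderiv ℝ f) := hf.continuous_fderiv (by norm_num)
  set γ : ℝ → EuclideanSpace ℝ (Fin n) := fun t => (1 - t) • y + t • x with hγ
  have hγc : Continuous γ := by fun_prop
  have hγd : ∀ t, HasDerivAt γ (x - y) t := by
    intro t
    have h1 : HasDerivAt (fun t : ℝ => (1 - t) • y) ((-1 : ℝ) • y) t :=
      HasDerivAt.smul_const (by simpa using (hasDerivAt_id t).const_sub 1) y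
    have h2 : HasDerivAt (fun t : ℝ => t • x) ((1 : ℝ) • x) t :=
      HasDerivAt.smul_const (hasDerivAt_id t) x
    exact (h1.add h2).congr_deriv (by rw [neg_one_smul, one_smul]; abel)
  set h : ℝ → ℝ := fun t => fderiv ℝ f (γ t) (x - y) with hh
  have hhc : Continuous h := (hdf.comp hγc).clm_apply continuous_const
  have hder : ∀ t, HasDerivAt (f ∘ γ) (h t) t := fun t =>
    ((hf.differentiable (by norm_num)) (γ t)).hasFDerivAt.comp_hasDerivAt t (hγd t)
  have hinter : ∫ t in (0:ℝ)..1, h t = f x - f y := by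
    rw [intervalIntegral.integral_eq_sub_of_hasDerivAt (fun t _ => hder t)
      (hhc.intervalIntegrable _ _)]
    simp [hγ]
  rw [intervalIntegral.integral_of_le zero_le_one] at hinter
  have : IsProbabilityMeasure (volume.restrict (Set.Ioc (0:ℝ) 1)) := ⟨by simp⟩
  have hI : ∀ {u : ℝ → ℝ}, Continuous u → Integrable u (volume.restrict (Set.Ioc (0:ℝ) 1)) :=
    fun hu => (hu.integrableOn_Icc (a := 0) (b := 1)).mono_set Set.Ioc_subset_Icc_self
  have hJ : (∫ t in Set.Ioc (0:ℝ) 1, h t) ^ 2 ≤ ∫ t in Set.Ioc (0:ℝ) 1, (h t) ^ 2 :=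
    ConvexOn.map_integral_le (g := fun x : ℝ => x ^ 2) (s := Set.univ) (even_two.convexOn_pow)
      (by fun_prop) isClosed_univ (by simp) (hI hhc) (hI (by fun_prop))
  rw [← hinter]
  refine (ENNReal.ofReal_le_ofReal hJ).trans ?_
  rw [ofReal_integral_eq_lintegral_ofReal (hI (by fun_prop)) (Filter.Eventually.of_forall fun _ => sq_nonneg _)]
  refine lintegral_mono fun t => ?_
  rw [← ENNReal.ofReal_mul (sq_nonneg _)]
  refine ENNReal.ofReal_le_ofReal ?_
  have h1 : |h t| ≤ ‖fderiv ℝ f (γ t)‖ * ‖x - y‖ := by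
    exact (fderiv ℝ f (γ t)).le_opNorm (x - y)
  have h2 : |h t| ≤ D * ‖fderiv ℝ f (γ t)‖ := by
    rw [mul_comm]
    exact h1.trans (by gcongr)
  calc h t ^ 2 = |h t| ^ 2 := (sq_abs _).symm
    _ ≤ (D * ‖fderiv ℝ f (γ t)‖) ^ 2 := by gcongr
    _ = _ := by rw [mul_pow]

lemma lint_scale (g : EuclideanSpace ℝ (Fin n) → ENNReal)
    (hg : Measurable g) (w : EuclideanSpace ℝ (Fin n)) (t : ℝ) (ht : 1 / 2 ≤ t) :
    ∫⁻ x, g (w + t • x) ≤ 2 ^ n * ∫⁻ x, g x := by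
  have ht0 : 0 < t := by linarith
  have h1 : ∫⁻ x, g (w + t • x) = ∫⁻ x, g (w + x) ∂(Measure.map (fun x => t • x) volume) := by
    rw [lintegral_map (f := fun x => g (w + x)) (by fun_prop) (by fun_prop)]
  rw [h1, Measure.map_addHaar_smul _ ht0.ne', lintegral_smul_measure, lintegral_add_left_eq_self]
  rw [smul_eq_mul]
  gcongr
  rw [finrank_euclideanSpace_fin, abs_of_pos (by positivity), ← inv_pow]
  rw [show (2 : ENNReal) ^ n = ENNReal.ofReal (2 ^ n) by
    rw [ENNReal.ofReal_pow (by norm_num)]; norm_num]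
  refine ENNReal.ofReal_le_ofReal ?_
  gcongr
  rw [inv_le_comm₀ ht0 (by norm_num)]
  linarith

lemma poincare (Ω : Set (EuclideanSpace ℝ (Fin n))) (hc : IsCompact Ω) (hconv : Convex ℝ Ω)
    (hpos : volume Ω ≠ 0) :
    ∃ K : ℝ, 0 < K ∧ ∀ f : EuclideanSpace ℝ (Fin n) → ℝ, ContDiff ℝ 1 f →
      ∫ x in Ω, f x = 0 → ∫ x in Ω, f x ^ 2 ≤ K * ∫ x in Ω, ‖fderiv ℝ f x‖ ^ 2 := by
  set D := Metric.diam Ω with hDdef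
  refine ⟨D ^ 2 * 2 ^ n + 1, by positivity, ?_⟩
  intro f hf hmean
  have hdf : Continuous (fderiv ℝ f) := hf.continuous_fderiv (by norm_num)
  have hfc : Continuous f := hf.continuous
  have hmeas : MeasurableSet Ω := hc.measurableSet
  have hfin : volume Ω ≠ ⊤ := hc.measure_lt_top.ne
  have : IsFiniteMeasure (volume.restrict Ω) := ⟨by simpa using hc.measure_lt_top⟩
  have hI : ∀ {u : EuclideanSpace ℝ (Fin n) → ℝ}, Continuous u → IntegrableOn u Ω :=
    fun hu => hu.continuousOn.integrableOn_compact hc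
  set g : EuclideanSpace ℝ (Fin n) → ENNReal :=
    Ω.indicator (fun z => ENNReal.ofReal (‖fderiv ℝ f z‖ ^ 2)) with hg
  have hgm : Measurable g := by
    refine Measurable.indicator ?_ hmeas
    have : Continuous fun z => ‖fderiv ℝ f z‖ ^ 2 := by fun_prop
    exact this.measurable.ennreal_ofReal
  have hGint : ∫⁻ z, g z = ENNReal.ofReal (∫ x in Ω, ‖fderiv ℝ f x‖ ^ 2) := by
    rw [hg, lintegral_indicator hmeas, ofReal_integral_eq_lintegral_ofReal (hI (by fun_prop))
      (Filter.Eventually.of_forall fun _ => sq_nonneg _)]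
  -- the double integral
  have upper : ∫⁻ x in Ω, ∫⁻ y in Ω, ENNReal.ofReal ((f x - f y) ^ 2) ≤
      ENNReal.ofReal (D ^ 2) * (volume Ω * (2 ^ n * ∫⁻ z, g z)) := by
    have s1 : ∫⁻ x in Ω, ∫⁻ y in Ω, ENNReal.ofReal ((f x - f y) ^ 2) ≤
        ∫⁻ x in Ω, ∫⁻ y in Ω, ∫⁻ t in Set.Ioc (0:ℝ) 1, ENNReal.ofReal (D ^ 2) *
          g ((1 - t) • y + t • x) := by
      refine setLIntegral_mono' hmeas fun x hx => ?_
      refine setLIntegral_mono' hmeas fun y hy => ?_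
      refine (pw_bound f hf x y D ?_).trans ?_
      · rw [← dist_eq_norm]; exact Metric.dist_le_diam_of_mem hc.isBounded hx hy
      · refine setLIntegral_mono' measurableSet_Ioc fun t ht => ?_
        rw [hg, Set.indicator_of_mem]
        exact hconv hy hx (by linarith [ht.2]) ht.1.le (by ring)
    refine s1.trans ?_
    have m3 : Measurable fun p : (EuclideanSpace ℝ (Fin n) × EuclideanSpace ℝ (Fin n)) × ℝ =>
        ENNReal.ofReal (D ^ 2) * g ((1 - p.2) • p.1.2 + p.2 • p.1.1) := by
      refine Measurable.const_mul (hgm.comp ?_) _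
      have : Continuous fun p : (EuclideanSpace ℝ (Fin n) × EuclideanSpace ℝ (Fin n)) × ℝ =>
         ((1 - p.2) • p.1.2 + p.2 • p.1.1) := by fun_prop
      exact this.measurable
    have s2 : ∫⁻ x in Ω, ∫⁻ y in Ω, ∫⁻ t in Set.Ioc (0:ℝ) 1, ENNReal.ofReal (D ^ 2) *
          g ((1 - t) • y + t • x) =
        ∫⁻ t in Set.Ioc (0:ℝ) 1, ∫⁻ x in Ω, ∫⁻ y in Ω, ENNReal.ofReal (D ^ 2) *
          g ((1 - t) • y + t • x) := by
      have : ∀ x, ∫⁻ y in Ω, ∫⁻ t in Set.Ioc (0:ℝ) 1, ENNReal.ofReal (D ^ 2) *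
          g ((1 - t) • y + t • x) = ∫⁻ t in Set.Ioc (0:ℝ) 1, ∫⁻ y in Ω, ENNReal.ofReal (D ^ 2) *
          g ((1 - t) • y + t • x) := by
        intro x
        refine lintegral_lintegral_swap (Measurable.aemeasurable ?_)
        exact m3.comp (f := fun q : EuclideanSpace ℝ (Fin n) × ℝ => ((x, q.1), q.2)) (by fun_prop)
      simp_rw [this]
      refine lintegral_lintegral_swap (Measurable.aemeasurable ?_)
      have m4 : Measurable fun p : (EuclideanSpace ℝ (Fin n) × ℝ) × EuclideanSpace ℝ (Fin n) =>
        ENNReal.ofReal (D ^ 2) * g ((1 - p.1.2) • p.2 + p.1.2 • p.1.1) :=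
        m3.comp (f := fun q : (EuclideanSpace ℝ (Fin n) × ℝ) × EuclideanSpace ℝ (Fin n) =>
          ((q.1.1, q.2), q.1.2)) (by fun_prop)
      exact m4.lintegral_prod_right'
    rw [s2]
    have s3 : ∀ t ∈ Set.Ioc (0:ℝ) 1, ∫⁻ x in Ω, ∫⁻ y in Ω, ENNReal.ofReal (D ^ 2) *
          g ((1 - t) • y + t • x) ≤ ENNReal.ofReal (D ^ 2) * (volume Ω * (2 ^ n * ∫⁻ z, g z)) := by
      intro t ht
      have mt : Measurable fun p : EuclideanSpace ℝ (Fin n) × EuclideanSpace ℝ (Fin n) =>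
        ENNReal.ofReal (D ^ 2) * g ((1 - t) • p.2 + t • p.1) :=
        m3.comp (f := fun q => (q, t)) (by fun_prop)
      have key : ∀ (w : EuclideanSpace ℝ (Fin n)) (s : ℝ), 1 / 2 ≤ s →
          ∫⁻ y in Ω, ENNReal.ofReal (D ^ 2) * g (w + s • y) ≤
            ENNReal.ofReal (D ^ 2) * (2 ^ n * ∫⁻ z, g z) := by
        intro w s hs
        have hgw : Measurable fun y => g (w + s • y) :=
          hgm.comp (f := fun y => w + s • y) (by fun_prop)
        rw [lintegral_const_mul _ hgw]
        gcongr
        exact (setLIntegral_le_lintegral _ _).trans (lint_scale g hgm w s hs)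
      have fin : ∫⁻ _ in Ω, ENNReal.ofReal (D ^ 2) * (2 ^ n * ∫⁻ z, g z) =
          ENNReal.ofReal (D ^ 2) * (volume Ω * (2 ^ n * ∫⁻ z, g z)) := by
        rw [setLIntegral_const]; ring
      rw [← fin]
      rcases le_total t (1/2) with h | h
      · refine lintegral_mono fun x => ?_
        have := key (t • x) (1 - t) (by linarith)
        simpa only [add_comm] using this
      · rw [lintegral_lintegral_swap mt.aemeasurable]
        exact lintegral_mono fun y => key ((1 - t) • y) t h
    refine (setLIntegral_mono' measurableSet_Ioc s3).trans ?_
    simp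
  have lower : ENNReal.ofReal ((volume Ω).toReal * ∫ x in Ω, f x ^ 2) ≤
      ∫⁻ x in Ω, ∫⁻ y in Ω, ENNReal.ofReal ((f x - f y) ^ 2) := by
    rw [← integral_const_mul, ofReal_integral_eq_lintegral_ofReal ((hI (by fun_prop)).const_mul _)
      (Filter.Eventually.of_forall fun _ => by positivity)]
    refine lintegral_mono fun x => ?_
    rw [← ofReal_integral_eq_lintegral_ofReal (hI (by fun_prop))
      (Filter.Eventually.of_forall fun _ => sq_nonneg _)]
    refine ENNReal.ofReal_le_ofReal ?_
    have e : ∫ y in Ω, (f x - f y) ^ 2 =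
        ∫ y in Ω, (f x ^ 2 + (-(2 * f x)) * f y + f y ^ 2) := by
      congr 1; ext y; ring
    rw [e, integral_add (hI (by fun_prop)) (hI (by fun_prop)),
      integral_add (hI (by fun_prop)) (hI (by fun_prop)), integral_const_mul, hmean]
    have : 0 ≤ ∫ y in Ω, f y ^ 2 := integral_nonneg fun _ => sq_nonneg _
    simp [Measure.real]
    exact this
  have tot := lower.trans upper
  have hG0 : 0 ≤ ∫ x in Ω, ‖fderiv ℝ f x‖ ^ 2 := integral_nonneg fun _ => sq_nonneg _
  have hV : 0 < (volume Ω).toReal := ENNReal.toReal_pos hpos hfin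
  rw [hGint, ← ENNReal.ofReal_toReal hfin, show (2 : ENNReal) ^ n = ENNReal.ofReal (2 ^ n) by
    rw [ENNReal.ofReal_pow (by norm_num)]; norm_num, ← ENNReal.ofReal_mul (by positivity),
    ← ENNReal.ofReal_mul (by positivity), ← ENNReal.ofReal_mul (by positivity),
    ENNReal.toReal_ofReal hV.le,
    ENNReal.ofReal_le_ofReal_iff (by positivity)] at tot
  have : (∫ x in Ω, f x ^ 2) ≤ D ^ 2 * 2 ^ n * ∫ x in Ω, ‖fderiv ℝ f x‖ ^ 2 := by
    refine le_of_mul_le_mul_left ?_ hV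
    linarith
  linarith

end Poincare


section Bdd
variable {n : ℕ}

lemma sq_int_pos (Ω : Set (EuclideanSpace ℝ (Fin n))) (hc : IsCompact Ω) (hconv : Convex ℝ Ω)
    (hinter : (interior Ω).Nonempty) (f : EuclideanSpace ℝ (Fin n) → ℝ) (hf : Continuous f)
    (h0 : ∫ x in Ω, f x ^ 2 = 0) : ∀ x ∈ Ω, f x = 0 := by
  have h1 := (setIntegral_eq_zero_iff_of_nonneg_ae (μ := volume)
    (Filter.Eventually.of_forall fun _ => sq_nonneg _)
    ((hf.pow 2).continuousOn.integrableOn_compact hc)).1 h0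
  have h2 : f =ᵐ[volume.restrict (interior Ω)] (fun _ => 0) := by
    have := ae_restrict_of_ae_restrict_of_subset interior_subset h1
    filter_upwards [this] with x hx
    simpa using hx
  have h3 := Measure.eqOn_open_of_ae_eq h2 isOpen_interior hf.continuousOn continuousOn_const
  have h4 : Set.EqOn f (fun _ => 0) (closure (interior Ω)) :=
    h3.closure hf continuous_const
  rw [hconv.closure_interior_eq_closure_of_nonempty_interior hinter] at h4
  exact fun x hx => h4 (subset_closure hx)

lemma norm_sq_toLp {F : Type*} [NormedAddCommGroup F] [NormedSpace ℝ F]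
    (μ : Measure (EuclideanSpace ℝ (Fin n))) (u : EuclideanSpace ℝ (Fin n) → F)
    (hu : MemLp u 2 μ) : ‖hu.toLp u‖ ^ 2 = ∫ x, ‖u x‖ ^ 2 ∂μ := by
  have h0 : 0 ≤ ∫ x, ‖u x‖ ^ 2 ∂μ := integral_nonneg fun _ => by positivity
  rw [Lp.norm_toLp, hu.eLpNorm_eq_integral_rpow_norm (by norm_num) (by norm_num)]
  simp only [ENNReal.toReal_ofNat, Real.rpow_two]
  rw [ENNReal.toReal_ofReal (by positivity), ← Real.rpow_natCast, ← Real.rpow_mul h0]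
  norm_num

lemma rayleigh_bdd (Ω : Set (EuclideanSpace ℝ (Fin n))) (hc : IsCompact Ω) (hconv : Convex ℝ Ω)
    (hinter : (interior Ω).Nonempty) (V : Submodule ℝ (EuclideanSpace ℝ (Fin n) → ℝ))
    [FiniteDimensional ℝ V] (hV : ∀ f ∈ V, ContDiff ℝ 1 f)
    (hV0 : ∀ f ∈ V, (∀ x ∈ Ω, f x = 0) → f = 0) :
    ∃ C : ℝ, ∀ f ∈ V, ∫ x in Ω, ‖fderiv ℝ f x‖ ^ 2 ≤ C * ∫ x in Ω, f x ^ 2 := by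
  set μ := (volume : Measure (EuclideanSpace ℝ (Fin n))).restrict Ω with hμ
  have : IsFiniteMeasure μ := ⟨by simpa [hμ] using hc.measure_lt_top⟩
  have mem : ∀ {F : Type} [NormedAddCommGroup F] [NormedSpace ℝ F]
      [SecondCountableTopology F] (u : EuclideanSpace ℝ (Fin n) → F),
      Continuous u → MemLp u 2 μ := by
    intro F _ _ _ u hu
    obtain ⟨C, hC⟩ := hc.exists_bound_of_continuousOn hu.continuousOn
    exact MemLp.of_bound hu.aestronglyMeasurable C
      ((ae_restrict_iff' hc.measurableSet).2 (Filter.Eventually.of_forall hC))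
  have mA : ∀ f : V, MemLp (f : EuclideanSpace ℝ (Fin n) → ℝ) 2 μ :=
    fun f => mem _ (hV f f.2).continuous
  have mB : ∀ f : V, MemLp (fderiv ℝ (f : EuclideanSpace ℝ (Fin n) → ℝ)) 2 μ :=
    fun f => mem _ ((hV f f.2).continuous_fderiv (by norm_num))
  let A : V →ₗ[ℝ] Lp ℝ 2 μ :=
    { toFun := fun f => (mA f).toLp _
      map_add' := fun f g => MemLp.toLp_add (mA f) (mA g)
      map_smul' := fun c f => MemLp.toLp_const_smul c (mA f) }
  let B : V →ₗ[ℝ] Lp (EuclideanSpace ℝ (Fin n) →L[ℝ] ℝ) 2 μ :=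
    { toFun := fun f => (mB f).toLp _
      map_add' := fun f g => by
        rw [← MemLp.toLp_add (mB f) (mB g)]
        refine MemLp.toLp_congr _ _ (Filter.Eventually.of_forall fun x => ?_)
        exact fderiv_add ((hV f f.2).differentiable (by norm_num) x)
          ((hV g g.2).differentiable (by norm_num) x)
      map_smul' := fun c f => by
        rw [RingHom.id_apply, ← MemLp.toLp_const_smul c (mB f)]
        refine MemLp.toLp_congr _ _ (Filter.Eventually.of_forall fun x => ?_)
        exact fderiv_const_smul ((hV f f.2).differentiable (by norm_num) x) c }
  have nA : ∀ f : V, ‖A f‖ ^ 2 = ∫ x in Ω, f.1 x ^ 2 := by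
    intro f
    have := norm_sq_toLp μ _ (mA f)
    simp only [Real.norm_eq_abs, sq_abs] at this
    exact this
  have nB : ∀ f : V, ‖B f‖ ^ 2 = ∫ x in Ω, ‖fderiv ℝ f.1 x‖ ^ 2 := 
    fun f => norm_sq_toLp μ _ (mB f)
  have inj : Function.Injective A := by
    rw [← LinearMap.ker_eq_bot, LinearMap.ker_eq_bot']
    intro f hf
    have h1 := nA f
    rw [hf] at h1
    simp only [norm_zero, ne_eq, OfNat.ofNat_ne_zero, not_false_eq_true, zero_pow] at h1
    exact Subtype.ext (hV0 f f.2 (sq_int_pos Ω hc hconv hinter f (hV f f.2).continuous h1.symm))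
  let e := LinearEquiv.ofInjective A inj
  let L : A.range →ₗ[ℝ] Lp (EuclideanSpace ℝ (Fin n) →L[ℝ] ℝ) 2 μ := B ∘ₗ e.symm.toLinearMap
  let L' := LinearMap.toContinuousLinearMap L
  refine ⟨‖L'‖ ^ 2, fun f hf => ?_⟩
  have h1 := L'.le_opNorm (e ⟨f, hf⟩)
  have h2 : L' (e ⟨f, hf⟩) = B ⟨f, hf⟩ := by simp [L', L]
  have h3 : ‖e ⟨f, hf⟩‖ = ‖A ⟨f, hf⟩‖ := rfl
  rw [h2, h3] at h1
  have := pow_le_pow_left₀ (norm_nonneg _) h1 2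
  rwa [mul_pow, nA, nB] at this

end Bdd


lemma bump_one_dim : ∃ C : ℝ, 0 < C ∧ ∀ a r : ℝ, 0 < a → 0 < r →
    ∃ (w : ℕ → ℝ → ℝ) (p : ℕ → ℝ), (∀ j, ContDiff ℝ (⊤ : ℕ∞) (w j)) ∧
      (∀ j, j < max 1 ⌊2 * a / r⌋₊ → |p j| ≤ a) ∧
      (∀ i j, i < max 1 ⌊2 * a / r⌋₊ → j < max 1 ⌊2 * a / r⌋₊ →
        w i (p j) = if i = j then 1 else 0) ∧
      (∀ i j, i < max 1 ⌊2 * a / r⌋₊ → j < max 1 ⌊2 * a / r⌋₊ → i ≠ j → ∀ t,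
        (w i t = 0 ∧ deriv (w i) t = 0) ∨ (w j t = 0 ∧ deriv (w j) t = 0)) ∧
      (∀ j, j < max 1 ⌊2 * a / r⌋₊ → ∫ t in Set.Icc (-a) a, (deriv (w j) t) ^ 2 ≤
        C / r ^ 2 * ∫ t in Set.Icc (-a) a, (w j t) ^ 2) := by
  let u : ContDiffBump (0:ℝ) := ⟨1/4, 1/3, by norm_num, by norm_num⟩
  have hu : ContDiff ℝ (⊤ : ℕ∞) u := u.contDiff
  have hu0 : u 0 = 1 := u.one_of_mem_closedBall (by simp [u])
  have huz : ∀ t : ℝ, 1/2 ≤ |t| → u t = 0 := by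
    intro t ht
    apply u.zero_of_le_dist
    simp only [dist_zero_right, Real.norm_eq_abs, u]
    linarith
  have hudz : ∀ t : ℝ, 1/2 ≤ |t| → deriv u t = 0 := by
    intro t ht
    have : (u : ℝ → ℝ) =ᶠ[nhds t] fun _ => (0:ℝ) := by
      have ho : {s : ℝ | 1/3 < |s|} ∈ nhds t :=
        (isOpen_lt continuous_const continuous_abs).mem_nhds (by
          show (1/3 : ℝ) < |t|
          linarith)
      filter_upwards [ho] with s hs
      apply u.zero_of_le_dist
      simp only [dist_zero_right, Real.norm_eq_abs, u]
      exact le_of_lt hs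
    rw [this.deriv_eq]; simp
  set I0 := ∫ t, (u t) ^ 2 with hI0
  set I1 := ∫ t, (deriv u t) ^ 2 with hI1
  have hI0pos : 0 < I0 := by
    refine Continuous.integral_pos_of_hasCompactSupport_nonneg_nonzero (x := 0)
      (by have := hu.continuous; fun_prop) ?_ (fun t => sq_nonneg _) (by simp [hu0])
    have := u.hasCompactSupport
    simp only [pow_two]
    exact HasCompactSupport.mul_right (f' := (u : ℝ → ℝ)) this
  have hI1nn : 0 ≤ I1 := integral_nonneg fun _ => sq_nonneg _
  refine ⟨I1 / I0 + 1, by positivity, ?_⟩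
  intro a r ha hr
  by_cases hN : ⌊2 * a / r⌋₊ ≤ 1
  · rw [max_eq_left hN]
    refine ⟨fun _ _ => 1, fun _ => 0, fun _ => contDiff_const, by simp [ha.le], ?_, ?_, ?_⟩
    · intro i j hi hj
      simp [show i = j by omega]
    · intro i j hi hj hij; omega
    · intro j _
      simp only [deriv_const', ne_eq, OfNat.ofNat_ne_zero, not_false_eq_true, zero_pow,
        integral_zero]
      refine mul_nonneg (by positivity) (integral_nonneg fun _ => by positivity)
  · push Not at hN
    rw [max_eq_right hN.le]
    set N := ⌊2 * a / r⌋₊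
    have hNr : N * r ≤ 2 * a := by
      have := Nat.floor_le (a := 2 * a / r) (by positivity)
      rwa [le_div_iff₀ hr] at this
    let p : ℕ → ℝ := fun j => -a + (j + 1/2) * r
    have hd : ∀ j t, deriv (fun t => u ((t - p j) / r)) t = deriv u ((t - p j) / r) / r := by
      intro j t
      have h1 : HasDerivAt (fun t => (t - p j) / r) (1 / r) t :=
        ((hasDerivAt_id t).sub_const _).div_const r
      have h2 : HasDerivAt u (deriv u ((t - p j) / r)) ((t - p j) / r) :=
        (hu.differentiable (by simp) _).hasDerivAt
      have := (h2.comp t h1).deriv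
      simp only [Function.comp_def] at this
      rw [this]; ring
    have hpb : ∀ j, j < N → -a + r / 2 ≤ p j ∧ p j ≤ a - r / 2 := by
      intro j hj
      have : (j : ℝ) + 1 ≤ N := by exact_mod_cast hj
      have h2 : ((j : ℝ) + 1) * r ≤ N * r := by gcongr
      have h3 : 0 ≤ (j : ℝ) * r := by positivity
      simp only [p]
      constructor <;> nlinarith
    have far : ∀ i j : ℕ, i ≠ j → ∀ t, 1/2 ≤ |(t - p i) / r| ∨ 1/2 ≤ |(t - p j) / r| := by
      intro i j hij t
      by_contra hcon
      push Not at hcon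
      have h1 : (t - p j) / r - (t - p i) / r = (i : ℝ) - j := by
        simp only [p]; field_simp; ring
      have h2 : (1 : ℝ) ≤ |(i : ℝ) - j| := by
        have : (1 : ℤ) ≤ |(i : ℤ) - j| := Int.one_le_abs (by omega)
        exact_mod_cast this
      have := abs_sub ((t - p j) / r) ((t - p i) / r)
      rw [h1] at this
      linarith [hcon.1, hcon.2]
    refine ⟨fun j t => u ((t - p j) / r), p, ?_, ?_, ?_, ?_, ?_⟩
    · intro j
      exact hu.comp (by fun_prop)
    · intro j hj
      have := hpb j hj
      rw [abs_le]; constructor <;> linarith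
    · intro i j hi hj
      split_ifs with h
      · subst h; simp [hu0]
      · apply huz
        rcases far i j h (p j) with h | h
        · exact h
        · simp at h; norm_num at h
    · intro i j hi hj hij t
      simp only [hd]
      rcases far i j hij t with h | h
      · left; simp [huz _ h, hudz _ h]
      · right; simp [huz _ h, hudz _ h]
    · intro j hj
      have hout : ∀ t, t ∉ Set.Icc (-a) a → 1/2 ≤ |(t - p j) / r| := by
        intro t ht
        have hp := hpb j hj
        rw [abs_div, abs_of_pos hr, le_div_iff₀ hr]
        rw [Set.mem_Icc, not_and_or] at ht
        push Not at ht
        rcases ht with h | h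
        · rw [abs_of_nonpos] <;> linarith
        · rw [abs_of_nonneg] <;> linarith
      simp only [hd]
      rw [setIntegral_eq_integral_of_forall_compl_eq_zero
        (fun t ht => by simp [hudz _ (hout t ht)]),
        setIntegral_eq_integral_of_forall_compl_eq_zero
        (fun t ht => by simp [huz _ (hout t ht)])]
      have e0 : ∫ t, u ((t - p j) / r) ^ 2 = r * I0 := by
        rw [integral_sub_right_eq_self (fun t => u (t / r) ^ 2) (p j),
          Measure.integral_comp_div (fun t => u t ^ 2) r, abs_of_pos hr, smul_eq_mul]
      have e1 : ∫ t, (deriv u ((t - p j) / r) / r) ^ 2 = r * (I1 / r ^ 2) := by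
        rw [integral_sub_right_eq_self (fun t => (deriv u (t / r) / r) ^ 2) (p j),
          Measure.integral_comp_div (fun t => (deriv u t / r) ^ 2) r, abs_of_pos hr, smul_eq_mul]
        simp only [div_pow, integral_div, hI1]
      rw [e0, e1]
      have : (I1 / I0 + 1) / r ^ 2 * (r * I0) = r * (I1 / r^2) + I0 / r := by
        field_simp
      rw [this]
      have : 0 ≤ I0 / r := by positivity
      linarith


section Box
variable {n : ℕ}

lemma opnorm_sq_le (L : EuclideanSpace ℝ (Fin n) →L[ℝ] ℝ) :
    ‖L‖ ^ 2 ≤ ∑ i, (L (EuclideanSpace.single i (1:ℝ))) ^ 2 := by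
  set S := ∑ i, (L (EuclideanSpace.single i (1:ℝ))) ^ 2 with hS
  have hS0 : 0 ≤ S := Finset.sum_nonneg fun _ _ => sq_nonneg _
  have : ‖L‖ ≤ Real.sqrt S := by
    refine L.opNorm_le_bound (Real.sqrt_nonneg _) fun v => ?_
    have hv : L v = ∑ i, L (EuclideanSpace.single i (1:ℝ)) * v i := by
      conv_lhs => rw [← (EuclideanSpace.basisFun (Fin n) ℝ).sum_repr v]
      simp [mul_comm]
    rw [Real.norm_eq_abs, EuclideanSpace.norm_eq, ← Real.sqrt_mul hS0]
    refine Real.abs_le_sqrt ?_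
    rw [hv]
    simpa using Finset.sum_mul_sq_le_sq_mul_sq Finset.univ
      (fun i => L (EuclideanSpace.single i (1:ℝ))) (fun i => v i)
  calc ‖L‖ ^ 2 ≤ Real.sqrt S ^ 2 := by gcongr
    _ = S := Real.sq_sqrt hS0

lemma box_integral (a : Fin n → ℝ) (h : Fin n → ℝ → ℝ) :
    ∫ x in {x : EuclideanSpace ℝ (Fin n) | ∀ i, |x i| ≤ a i}, ∏ k, h k (x k) =
      ∏ k, ∫ t in Set.Icc (-a k) (a k), h k t := by
  have hmp := EuclideanSpace.volume_preserving_symm_measurableEquiv_toLp (Fin n)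
  have h1 := hmp.setIntegral_preimage_emb (MeasurableEquiv.measurableEmbedding _)
    (fun y : Fin n → ℝ => ∏ k, h k (y k)) (Set.univ.pi fun i => Set.Icc (-a i) (a i))
  have h2 : (⇑(MeasurableEquiv.toLp 2 (Fin n → ℝ)).symm ⁻¹'
      (Set.univ.pi fun i => Set.Icc (-a i) (a i))) =
      {x : EuclideanSpace ℝ (Fin n) | ∀ i, |x i| ≤ a i} := by
    ext x
    simp only [Set.mem_preimage, Set.mem_univ_pi, Set.mem_Icc, Set.mem_setOf_eq, abs_le]
    rfl
  rw [h2] at h1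
  refine Eq.trans ?_ (h1.trans ?_)
  · rfl
  · rw [volume_pi, Measure.restrict_pi_pi, integral_fintype_prod_eq_prod]

lemma fderiv_prod_single (w : Fin n → ℝ → ℝ) (hw : ∀ k, Differentiable ℝ (w k))
    (x : EuclideanSpace ℝ (Fin n)) (i : Fin n) :
    fderiv ℝ (fun x : EuclideanSpace ℝ (Fin n) => ∏ k, w k (x k)) x
      (EuclideanSpace.single i (1:ℝ)) =
      ∏ k, (if k = i then deriv (w k) else w k) (x k) := by
  classical
  have hk : ∀ k, HasFDerivAt (fun x : EuclideanSpace ℝ (Fin n) => w k (x k))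
      (deriv (w k) (x k) • (EuclideanSpace.proj k : EuclideanSpace ℝ (Fin n) →L[ℝ] ℝ)) x := by
    intro k
    exact HasDerivAt.comp_hasFDerivAt x (hw k (x k)).hasDerivAt
      (EuclideanSpace.proj k : EuclideanSpace ℝ (Fin n) →L[ℝ] ℝ).hasFDerivAt
  rw [(HasFDerivAt.finsetProd (u := Finset.univ) fun k _ => hk k).fderiv]
  rw [sum_apply, Finset.sum_eq_single i]
  · rw [← Finset.prod_erase_mul _ _ (Finset.mem_univ i)]
    have e : (EuclideanSpace.proj i : EuclideanSpace ℝ (Fin n) →L[ℝ] ℝ)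
        (EuclideanSpace.single i (1:ℝ)) = 1 := by simp
    simp only [smul_apply, smul_eq_mul, e, mul_one, if_true]
    congr 1
    refine Finset.prod_congr rfl fun k hk => ?_
    rw [if_neg (Finset.ne_of_mem_erase hk)]
  · intro b _ hb
    simp [hb]
  · simp

lemma sq_sum_of_disjoint {ι : Type*} [Fintype ι] (c v : ι → ℝ)
    (hv : ∀ i j, i ≠ j → v i * v j = 0) : (∑ i, c i * v i) ^ 2 = ∑ i, c i ^ 2 * v i ^ 2 := by
  classical
  rw [pow_two, Finset.sum_mul_sum]
  refine Finset.sum_congr rfl fun i _ => ?_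
  rw [Finset.sum_eq_single i]
  · ring
  · intro j _ hj
    have := hv i j hj.symm
    calc c i * v i * (c j * v j) = c i * c j * (v i * v j) := by ring
      _ = 0 := by rw [this, mul_zero]
  · simp

lemma box_test (C : ℝ) (r : ℝ) (a : Fin n → ℝ) (N : Fin n → ℕ)
    (H : ∀ i, ∃ (w : ℕ → ℝ → ℝ) (p : ℕ → ℝ), (∀ j, ContDiff ℝ (⊤ : ℕ∞) (w j)) ∧
      (∀ j, j < N i → |p j| ≤ a i) ∧
      (∀ k j, k < N i → j < N i → w k (p j) = if k = j then 1 else 0) ∧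
      (∀ k j, k < N i → j < N i → k ≠ j → ∀ t,
        (w k t = 0 ∧ deriv (w k) t = 0) ∨ (w j t = 0 ∧ deriv (w j) t = 0)) ∧
      (∀ j, j < N i → ∫ t in Set.Icc (-a i) (a i), (deriv (w j) t) ^ 2 ≤
        C / r ^ 2 * ∫ t in Set.Icc (-a i) (a i), (w j t) ^ 2)) :
    ∃ (φ : (∀ i, Fin (N i)) → EuclideanSpace ℝ (Fin n) → ℝ)
      (q : (∀ i, Fin (N i)) → EuclideanSpace ℝ (Fin n)),
      (∀ j, ContDiff ℝ (⊤ : ℕ∞) (φ j)) ∧ (∀ j i, |q j i| ≤ a i) ∧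
      (∀ j, φ j (q j) = 1) ∧ (∀ j j', j ≠ j' → φ j (q j') = 0) ∧
      ∀ c : (∀ i, Fin (N i)) → ℝ,
        ∫ x in {x : EuclideanSpace ℝ (Fin n) | ∀ i, |x i| ≤ a i},
          ‖fderiv ℝ (fun x => ∑ j, c j * φ j x) x‖ ^ 2 ≤
        n * (C / r ^ 2) * ∫ x in {x : EuclideanSpace ℝ (Fin n) | ∀ i, |x i| ≤ a i},
          (∑ j, c j * φ j x) ^ 2 := by
  classical
  choose w p hws hp hwp hdis hinter using H
  set B := {x : EuclideanSpace ℝ (Fin n) | ∀ i, |x i| ≤ a i} with hB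
  have hBc : IsCompact B := by
    have h1 : IsCompact (Set.univ.pi fun i => Set.Icc (-a i) (a i)) :=
      isCompact_univ_pi fun i => isCompact_Icc
    have h2 := h1.image (PiLp.continuous_toLp 2 (fun _ : Fin n => ℝ))
    convert h2 using 1
    ext x
    constructor
    · intro hx
      refine ⟨WithLp.ofLp x, ?_, rfl⟩
      intro i _
      exact abs_le.1 (hx i)
    · rintro ⟨y, hy, rfl⟩ i
      exact abs_le.2 (hy i trivial)
  have hI : ∀ {u : EuclideanSpace ℝ (Fin n) → ℝ}, Continuous u → IntegrableOn u B :=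
    fun hu => hu.continuousOn.integrableOn_compact hBc
  let φ : (∀ i, Fin (N i)) → EuclideanSpace ℝ (Fin n) → ℝ := fun j x => ∏ k, w k (j k) (x k)
  let ψ : Fin n → (∀ i, Fin (N i)) → EuclideanSpace ℝ (Fin n) → ℝ := fun i j x =>
    ∏ k, (if k = i then deriv (w k (j k)) else w k (j k)) (x k)
  have hφs : ∀ j, ContDiff ℝ (⊤ : ℕ∞) (φ j) := by
    intro j
    refine contDiff_prod fun k _ => ?_
    exact (hws k (j k)).comp (EuclideanSpace.proj k : EuclideanSpace ℝ (Fin n) →L[ℝ] ℝ).contDiff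
  have hψc : ∀ i j, Continuous (ψ i j) := by
    intro i j
    refine continuous_finsetProd _ fun k _ => ?_
    have hx : Continuous fun x : EuclideanSpace ℝ (Fin n) => x k :=
      (EuclideanSpace.proj k : EuclideanSpace ℝ (Fin n) →L[ℝ] ℝ).continuous
    split_ifs
    · exact ((hws k (j k)).continuous_deriv (by simp)).comp hx
    · exact (hws k (j k)).continuous.comp hx
  have hφψ : ∀ j x i, fderiv ℝ (φ j) x (EuclideanSpace.single i (1:ℝ)) = ψ i j x := by
    intro j x i
    exact fderiv_prod_single (fun k => w k (j k))
      (fun k => (hws k (j k)).differentiable (by simp)) x i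
  have dφ : ∀ x j j', j ≠ j' → φ j x * φ j' x = 0 := by
    intro x j j' hj
    obtain ⟨k, hk⟩ := Function.ne_iff.1 hj
    rcases hdis k (j k) (j' k) (j k).2 (j' k).2 (fun h => hk (Fin.ext h)) (x k) with h | h
    · rw [show φ j x = 0 from Finset.prod_eq_zero (Finset.mem_univ k) h.1, zero_mul]
    · rw [show φ j' x = 0 from Finset.prod_eq_zero (Finset.mem_univ k) h.1, mul_zero]
  have dψ : ∀ i x j j', j ≠ j' → ψ i j x * ψ i j' x = 0 := by
    intro i x j j' hj
    obtain ⟨k, hk⟩ := Function.ne_iff.1 hj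
    rcases hdis k (j k) (j' k) (j k).2 (j' k).2 (fun h => hk (Fin.ext h)) (x k) with h | h
    · rw [show ψ i j x = 0 from Finset.prod_eq_zero (Finset.mem_univ k)
        (by split_ifs; exacts [h.2, h.1]), zero_mul]
    · rw [show ψ i j' x = 0 from Finset.prod_eq_zero (Finset.mem_univ k)
        (by split_ifs; exacts [h.2, h.1]), mul_zero]
  have one : ∀ i j, ∫ x in B, ψ i j x ^ 2 ≤ C / r ^ 2 * ∫ x in B, φ j x ^ 2 := by
    intro i j
    have e1 : ∫ x in B, ψ i j x ^ 2 = ∏ k, ∫ t in Set.Icc (-a k) (a k),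
        ((if k = i then deriv (w k (j k)) else w k (j k)) t) ^ 2 := by
      rw [← box_integral a (fun k t => ((if k = i then deriv (w k (j k)) else w k (j k)) t) ^ 2)]
      simp only [ψ, Finset.prod_pow, hB]
    have e2 : ∫ x in B, φ j x ^ 2 = ∏ k, ∫ t in Set.Icc (-a k) (a k), (w k (j k) t) ^ 2 := by
      rw [← box_integral a (fun k t => (w k (j k) t) ^ 2)]
      simp only [φ, Finset.prod_pow, hB]
    rw [e1, e2, ← Finset.prod_erase_mul _ _ (Finset.mem_univ i),
      ← Finset.prod_erase_mul (a := i) _ (fun k => ∫ t in Set.Icc (-a k) (a k), (w k (j k) t) ^ 2)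
        (Finset.mem_univ i)]
    rw [if_pos rfl]
    have e3 : ∏ k ∈ Finset.univ.erase i, ∫ t in Set.Icc (-a k) (a k),
        ((if k = i then deriv (w k (j k)) else w k (j k)) t) ^ 2 =
        ∏ k ∈ Finset.univ.erase i, ∫ t in Set.Icc (-a k) (a k), (w k (j k) t) ^ 2 := by
      refine Finset.prod_congr rfl fun k hk => ?_
      rw [if_neg (Finset.ne_of_mem_erase hk)]
    rw [e3]
    have h0 : 0 ≤ ∏ k ∈ Finset.univ.erase i, ∫ t in Set.Icc (-a k) (a k), (w k (j k) t) ^ 2 :=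
      Finset.prod_nonneg fun k _ => integral_nonneg fun _ => sq_nonneg _
    have := mul_le_mul_of_nonneg_left (hinter i (j i) (j i).2) h0
    linarith
  refine ⟨φ, fun j => WithLp.toLp 2 fun i => p i (j i), hφs, ?_, ?_, ?_, ?_⟩
  · intro j i
    exact hp i (j i) (j i).2
  · intro j
    refine Finset.prod_eq_one fun k _ => ?_
    show w k (j k) (p k (j k)) = 1
    rw [hwp k _ _ (j k).2 (j k).2, if_pos rfl]
  · intro j j' hj
    obtain ⟨k, hk⟩ := Function.ne_iff.1 hj
    refine Finset.prod_eq_zero (Finset.mem_univ k) ?_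
    show w k (j k) (p k (j' k)) = 0
    rw [hwp k _ _ (j k).2 (j' k).2, if_neg (fun h => hk (Fin.ext h))]
  · intro c
    set F : EuclideanSpace ℝ (Fin n) → ℝ := fun x => ∑ j, c j * φ j x with hF
    have hFs : ContDiff ℝ (⊤ : ℕ∞) F := ContDiff.sum fun j _ => contDiff_const.mul (hφs j)
    have hFd : ∀ x i, fderiv ℝ F x (EuclideanSpace.single i (1:ℝ)) = ∑ j, c j * ψ i j x := by
      intro x i
      have h1 : HasFDerivAt F (∑ j, c j • fderiv ℝ (φ j) x) x :=
        HasFDerivAt.fun_sum fun j _ =>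
          (((hφs j).differentiable (by simp) x).hasFDerivAt.const_mul (c j))
      rw [h1.fderiv, sum_apply]
      simp [hφψ]
    have hpt : ∀ x, ‖fderiv ℝ F x‖ ^ 2 ≤ ∑ i, ∑ j, c j ^ 2 * ψ i j x ^ 2 := by
      intro x
      refine (opnorm_sq_le _).trans (le_of_eq (Finset.sum_congr rfl fun i _ => ?_))
      rw [hFd, sq_sum_of_disjoint _ _ (dψ i x)]
    have hFc : Continuous (fderiv ℝ F) := hFs.continuous_fderiv (by simp)
    have hφc : ∀ j, Continuous (φ j) := fun j => (hφs j).continuous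
    calc ∫ x in B, ‖fderiv ℝ F x‖ ^ 2
        ≤ ∫ x in B, ∑ i, ∑ j, c j ^ 2 * ψ i j x ^ 2 :=
          integral_mono (hI (by fun_prop)) (hI (by fun_prop)) hpt
      _ = ∑ i, ∑ j, c j ^ 2 * ∫ x in B, ψ i j x ^ 2 := by
          rw [integral_finsetSum _ fun i _ => hI (by fun_prop)]
          refine Finset.sum_congr rfl fun i _ => ?_
          rw [integral_finsetSum _ fun j _ => hI (by fun_prop)]
          refine Finset.sum_congr rfl fun j _ => ?_
          rw [integral_const_mul]
      _ ≤ ∑ i : Fin n, ∑ j, c j ^ 2 * (C / r ^ 2 * ∫ x in B, φ j x ^ 2) := by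
          gcongr
          exact one _ _
      _ = n * (C / r ^ 2) * ∑ j, c j ^ 2 * ∫ x in B, φ j x ^ 2 := by
          rw [Finset.sum_const, Finset.card_univ, Fintype.card_fin, nsmul_eq_mul, mul_assoc]
          congr 1
          rw [Finset.mul_sum]
          refine Finset.sum_congr rfl fun j _ => by ring
      _ = n * (C / r ^ 2) * ∫ x in B, ∑ j, c j ^ 2 * φ j x ^ 2 := by
          rw [integral_finsetSum _ fun j _ => hI (by fun_prop)]
          simp only [integral_const_mul]
      _ = n * (C / r ^ 2) * ∫ x in B, F x ^ 2 := by
          congr 2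
          ext x
          rw [hF, sq_sum_of_disjoint _ _ (dφ x)]

end Box

section Geometry
variable {n : ℕ}

lemma isometry_form (T : EuclideanSpace ℝ (Fin n) ≃ᵢ EuclideanSpace ℝ (Fin n)) :
    ∃ (L : EuclideanSpace ℝ (Fin n) ≃ₗᵢ[ℝ] EuclideanSpace ℝ (Fin n))
      (b : EuclideanSpace ℝ (Fin n)), ∀ x, T x = L x + b := by
  refine ⟨T.toRealLinearIsometryEquiv, T 0, fun x => ?_⟩
  simp

lemma isometry_mp (T : EuclideanSpace ℝ (Fin n) ≃ᵢ EuclideanSpace ℝ (Fin n)) :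
    MeasurePreserving T volume volume := by
  obtain ⟨L, b, h⟩ := isometry_form T
  have h1 : (T : EuclideanSpace ℝ (Fin n) → EuclideanSpace ℝ (Fin n)) = (fun x => x + b) ∘ L :=
    funext h
  rw [h1]
  exact (measurePreserving_add_right volume b).comp L.measurePreserving

lemma isometry_fderiv (T : EuclideanSpace ℝ (Fin n) ≃ᵢ EuclideanSpace ℝ (Fin n))
    (f : EuclideanSpace ℝ (Fin n) → ℝ) (hf : ContDiff ℝ 1 f) (y : EuclideanSpace ℝ (Fin n)) :
    ‖fderiv ℝ (fun z => f (T z)) y‖ = ‖fderiv ℝ f (T y)‖ := by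
  obtain ⟨L, b, h⟩ := isometry_form T
  have h1 : HasFDerivAt T (L.toContinuousLinearEquiv : EuclideanSpace ℝ (Fin n) →L[ℝ] _) y := by
    have : (T : EuclideanSpace ℝ (Fin n) → EuclideanSpace ℝ (Fin n)) = fun x => L x + b :=
      funext h
    rw [this]
    exact (L.toContinuousLinearEquiv.hasFDerivAt).add_const b
  have h2 := ((hf.differentiable (by norm_num)) (T y)).hasFDerivAt.comp y h1
  have h3 : fderiv ℝ (fun z => f (T z)) y = _ := h2.fderiv
  rw [h3]
  exact ContinuousLinearMap.opNorm_comp_linearIsometryEquiv _ L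

lemma isometry_contDiff (T : EuclideanSpace ℝ (Fin n) ≃ᵢ EuclideanSpace ℝ (Fin n)) :
    ContDiff ℝ (⊤ : ℕ∞) T := by
  obtain ⟨L, b, h⟩ := isometry_form T
  have : (T : EuclideanSpace ℝ (Fin n) → EuclideanSpace ℝ (Fin n)) = fun x => L x + b :=
    funext h
  rw [this]
  exact L.contDiff.add contDiff_const

lemma isometry_convex (T : EuclideanSpace ℝ (Fin n) ≃ᵢ EuclideanSpace ℝ (Fin n))
    (S : Set (EuclideanSpace ℝ (Fin n))) (hS : Convex ℝ S) : Convex ℝ (T '' S) := by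
  obtain ⟨L, b, h⟩ := isometry_form T
  have h1 : T '' S = (fun z => z + b) '' (L.toLinearEquiv.toLinearMap '' S) := by
    rw [Set.image_image]
    exact Set.image_congr fun x _ => h x
  rw [h1]
  have h2 := (hS.linear_image L.toLinearEquiv.toLinearMap).translate b
  simpa only [add_comm] using h2

lemma box_compact (a : Fin n → ℝ) :
    IsCompact {x : EuclideanSpace ℝ (Fin n) | ∀ i, |x i| ≤ a i} := by
  have h1 : IsCompact (Set.univ.pi fun i => Set.Icc (-a i) (a i)) :=
    isCompact_univ_pi fun i => isCompact_Icc
  have h2 := h1.image (PiLp.continuous_toLp 2 (fun _ : Fin n => ℝ))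
  convert h2 using 1
  ext x
  constructor
  · intro hx
    refine ⟨WithLp.ofLp x, ?_, rfl⟩
    intro i _
    exact abs_le.1 (hx i)
  · rintro ⟨y, hy, rfl⟩ i
    exact abs_le.2 (hy i trivial)

lemma coord_convex (i : Fin n) (S : Set ℝ) (hS : Convex ℝ S) :
    Convex ℝ {x : EuclideanSpace ℝ (Fin n) | x i ∈ S} :=
  hS.linear_preimage (EuclideanSpace.proj i : EuclideanSpace ℝ (Fin n) →L[ℝ] ℝ).toLinearMap

lemma box_convex (a : Fin n → ℝ) :
    Convex ℝ {x : EuclideanSpace ℝ (Fin n) | ∀ i, |x i| ≤ a i} := by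
  have : {x : EuclideanSpace ℝ (Fin n) | ∀ i, |x i| ≤ a i} =
      ⋂ i, {x : EuclideanSpace ℝ (Fin n) | x i ∈ Set.Icc (-a i) (a i)} := by
    ext x; simp [abs_le]
  rw [this]
  exact convex_iInter fun i => coord_convex i _ (convex_Icc _ _)

lemma box_interior (a : Fin n → ℝ) (ha : ∀ i, 0 < a i) :
    (interior {x : EuclideanSpace ℝ (Fin n) | ∀ i, |x i| ≤ a i}).Nonempty := by
  refine ⟨0, mem_interior.2 ⟨{x | ∀ i, |x i| < a i}, fun x hx i => (hx i).le, ?_, ?_⟩⟩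
  · have : {x : EuclideanSpace ℝ (Fin n) | ∀ i, |x i| < a i} =
      ⋂ i, {x : EuclideanSpace ℝ (Fin n) | |x i| < a i} := by ext x; simp
    rw [this]
    refine isOpen_iInter_of_finite fun i => ?_
    exact isOpen_lt ((EuclideanSpace.proj i :
      EuclideanSpace ℝ (Fin n) →L[ℝ] ℝ).continuous.abs) continuous_const
  · intro i; simpa using ha i

end Geometry

section Eigen
variable {n : ℕ}

lemma eigen_le (l : ℕ) (Ω : Set (EuclideanSpace ℝ (Fin n))) (K : ℝ) (hK : 0 ≤ K)
    (V : Submodule ℝ (EuclideanSpace ℝ (Fin n) → ℝ))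
    (hV : Module.finrank ℝ V = l + 1 ∧ (∀ f ∈ V, ContDiff ℝ (⊤ : ℕ∞) f) ∧
      ∀ f ∈ V, (∀ x ∈ Ω, f x = 0) → f = 0)
    (hR : ∀ f ∈ V, ∫ x in Ω, ‖fderiv ℝ f x‖ ^ 2 ≤ K * ∫ x in Ω, (f x) ^ 2) :
    neumannEigenvalue n l Ω ≤ K := by
  have hnn : ∀ f : EuclideanSpace ℝ (Fin n) → ℝ,
      0 ≤ (∫ x in Ω, ‖fderiv ℝ f x‖ ^ 2) / ∫ x in Ω, (f x) ^ 2 := fun f =>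
    div_nonneg (integral_nonneg fun _ => sq_nonneg _) (integral_nonneg fun _ => sq_nonneg _)
  refine (ciInf_le ⟨0, ?_⟩ ⟨V, hV⟩).trans ?_
  · rintro _ ⟨W, rfl⟩
    exact Real.iSup_nonneg fun f => hnn f.1
  · refine Real.iSup_le (fun f => ?_) hK
    have h0 : 0 ≤ ∫ x in Ω, (f.1 x) ^ 2 := integral_nonneg fun _ => sq_nonneg _
    exact div_le_of_le_mul₀ h0 hK (hR f.1 f.2.1)

lemma eigen_pos (l : ℕ) (hl : 1 ≤ l) (Ω : Set (EuclideanSpace ℝ (Fin n)))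
    (hc : IsCompact Ω) (hconv : Convex ℝ Ω) (hinter : (interior Ω).Nonempty)
    (hne : ∃ V : Submodule ℝ (EuclideanSpace ℝ (Fin n) → ℝ),
      Module.finrank ℝ V = l + 1 ∧ (∀ f ∈ V, ContDiff ℝ (⊤ : ℕ∞) f) ∧
      ∀ f ∈ V, (∀ x ∈ Ω, f x = 0) → f = 0) :
    0 < neumannEigenvalue n l Ω := by
  have hpos : volume Ω ≠ 0 :=
    fun h => (isOpen_interior.measure_pos volume hinter).ne' (measure_mono_null interior_subset h)
  obtain ⟨K, hK, hP⟩ := poincare Ω hc hconv hpos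
  obtain ⟨V0, hV0⟩ := hne
  refine lt_of_lt_of_le (inv_pos.2 hK) ?_
  have : Nonempty {V : Submodule ℝ (EuclideanSpace ℝ (Fin n) → ℝ) //
      Module.finrank ℝ V = l + 1 ∧ (∀ f ∈ V, ContDiff ℝ (⊤ : ℕ∞) f) ∧
      ∀ f ∈ V, (∀ x ∈ Ω, f x = 0) → f = 0} := ⟨⟨V0, hV0⟩⟩
  refine le_ciInf fun W => ?_
  obtain ⟨V, hdim, hs, hz⟩ := W
  have hfd : FiniteDimensional ℝ V := FiniteDimensional.of_finrank_pos (by omega)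
  have hs1 : ∀ f ∈ V, ContDiff ℝ 1 f := fun f hf => (hs f hf).of_le (by exact_mod_cast le_top)
  have hsq : ∀ f ∈ V, f ≠ 0 → 0 < ∫ x in Ω, (f x) ^ 2 := by
    intro f hf hf0
    refine lt_of_le_of_ne (integral_nonneg fun _ => sq_nonneg _) fun h => hf0 ?_
    exact hz f hf (sq_int_pos Ω hc hconv hinter f (hs f hf).continuous h.symm)
  have hI : ∀ {u : EuclideanSpace ℝ (Fin n) → ℝ}, Continuous u → IntegrableOn u Ω :=
    fun hu => hu.continuousOn.integrableOn_compact hc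
  obtain ⟨C, hC⟩ := rayleigh_bdd Ω hc hconv hinter V hs1 hz
  let Λ : V →ₗ[ℝ] ℝ :=
    { toFun := fun f => ∫ x in Ω, f.1 x
      map_add' := fun f g => integral_add (hI (hs f f.2).continuous) (hI (hs g g.2).continuous)
      map_smul' := fun c f => integral_const_mul c _ }
  have hker : Λ.ker ≠ ⊥ := LinearMap.ker_ne_bot_of_finrank_lt (by
    rw [hdim, Module.finrank_self]; omega)
  obtain ⟨f, hfk, hf0⟩ := Submodule.exists_mem_ne_zero_of_ne_bot hker
  have hfm : ∫ x in Ω, f.1 x = 0 := hfk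
  have hf0' : f.1 ≠ 0 := fun h => hf0 (Subtype.ext h)
  have hb : BddAbove (Set.range fun f : {f : EuclideanSpace ℝ (Fin n) → ℝ // f ∈ V ∧ f ≠ 0} =>
      (∫ x in Ω, ‖fderiv ℝ f.1 x‖ ^ 2) / ∫ x in Ω, (f.1 x) ^ 2) := by
    refine ⟨C, ?_⟩
    rintro _ ⟨g, rfl⟩
    exact (div_le_iff₀ (hsq g.1 g.2.1 g.2.2)).2 (hC g.1 g.2.1)
  refine le_trans ?_ (le_ciSup hb ⟨f.1, f.2, hf0'⟩)
  rw [le_div_iff₀ (hsq f.1 f.2 hf0'), inv_mul_le_iff₀ hK]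
  exact hP f.1 (hs1 f f.2) hfm

lemma test_space (C : ℝ) (r : ℝ) (a : Fin n → ℝ) (N : Fin n → ℕ)
    (H : ∀ i, ∃ (w : ℕ → ℝ → ℝ) (p : ℕ → ℝ), (∀ j, ContDiff ℝ (⊤ : ℕ∞) (w j)) ∧
      (∀ j, j < N i → |p j| ≤ a i) ∧
      (∀ k j, k < N i → j < N i → w k (p j) = if k = j then 1 else 0) ∧
      (∀ k j, k < N i → j < N i → k ≠ j → ∀ t,
        (w k t = 0 ∧ deriv (w k) t = 0) ∨ (w j t = 0 ∧ deriv (w j) t = 0)) ∧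
      (∀ j, j < N i → ∫ t in Set.Icc (-a i) (a i), (deriv (w j) t) ^ 2 ≤
        C / r ^ 2 * ∫ t in Set.Icc (-a i) (a i), (w j t) ^ 2))
    (l : ℕ) (hl : l < ∏ i, N i)
    (T : EuclideanSpace ℝ (Fin n) ≃ᵢ EuclideanSpace ℝ (Fin n)) :
    ∃ V : Submodule ℝ (EuclideanSpace ℝ (Fin n) → ℝ),
      (Module.finrank ℝ V = l + 1 ∧ (∀ f ∈ V, ContDiff ℝ (⊤ : ℕ∞) f) ∧
      ∀ f ∈ V, (∀ x ∈ T '' {x : EuclideanSpace ℝ (Fin n) | ∀ i, |x i| ≤ a i}, f x = 0) → f = 0) ∧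
      ∀ f ∈ V, ∫ x in T '' {x : EuclideanSpace ℝ (Fin n) | ∀ i, |x i| ≤ a i},
          ‖fderiv ℝ f x‖ ^ 2 ≤ n * (C / r ^ 2) *
        ∫ x in T '' {x : EuclideanSpace ℝ (Fin n) | ∀ i, |x i| ≤ a i}, (f x) ^ 2 := by
  classical
  obtain ⟨φ, q, hs, hq, h1, h0, hR⟩ := box_test C r a N H
  obtain ⟨ι⟩ : Nonempty (Fin (l + 1) ↪ (∀ i, Fin (N i))) := by
    apply Function.Embedding.nonempty_of_card_le
    simp only [Fintype.card_fin, Fintype.card_pi]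
    omega
  let Ψ : ((∀ i, Fin (N i)) → ℝ) →ₗ[ℝ] (EuclideanSpace ℝ (Fin n) → ℝ) :=
    { toFun := fun c y => ∑ j, c j * φ j (T.symm y)
      map_add' := fun c d => by
        ext y; simp [add_mul, Finset.sum_add_distrib]
      map_smul' := fun s c => by
        ext y; simp [Finset.mul_sum, mul_assoc] }
  have hΨ : ∀ c y, Ψ c y = ∑ j, c j * φ j (T.symm y) := fun c y => rfl
  have hΨq : ∀ c j, Ψ c (T (q j)) = c j := by
    intro c j
    rw [hΨ, Finset.sum_eq_single j]
    · simp [h1]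
    · intro j' _ hj
      simp [h0 j' j hj]
    · simp
  let X := Function.ExtendByZero.linearMap ℝ (ι : Fin (l + 1) → (∀ i, Fin (N i)))
  have hinj : Function.Injective (Ψ ∘ₗ X) := by
    intro c d h
    ext i
    have h2 := congrFun h (T (q (ι i)))
    simp only [LinearMap.comp_apply, hΨq] at h2
    simpa [X, ι.injective.extend_apply] using h2
  refine ⟨(Ψ ∘ₗ X).range, ⟨?_, ?_, ?_⟩, ?_⟩
  · rw [LinearMap.finrank_range_of_inj hinj]; simp
  · rintro _ ⟨c, rfl⟩
    show ContDiff ℝ (⊤ : ℕ∞) fun y => ∑ j, X c j * φ j (T.symm y)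
    exact ContDiff.sum fun j _ => contDiff_const.mul ((hs j).comp (isometry_contDiff T.symm))
  · rintro _ ⟨c, rfl⟩ h
    have : X c = 0 := by
      ext j
      have := h (T (q j)) ⟨q j, hq j, rfl⟩
      rwa [LinearMap.comp_apply, hΨq] at this
    rw [LinearMap.comp_apply, this, map_zero]
  · rintro _ ⟨c, rfl⟩
    have hmp := isometry_mp T
    have hemb : MeasurableEmbedding T := T.toHomeomorph.measurableEmbedding
    rw [hmp.setIntegral_image_emb hemb, hmp.setIntegral_image_emb hemb]
    have hF : ContDiff ℝ 1 (fun x => ∑ j, X c j * φ j x) :=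
      ContDiff.sum fun j _ => contDiff_const.mul ((hs j).of_le (by exact_mod_cast le_top))
    have e1 : ∀ x, ‖fderiv ℝ ((Ψ ∘ₗ X) c) (T x)‖ = ‖fderiv ℝ (fun x => ∑ j, X c j * φ j x) x‖ := by
      intro x
      have := isometry_fderiv T.symm _ hF (T x)
      rw [T.symm_apply_apply] at this
      exact this
    have e2 : ∀ x, (Ψ ∘ₗ X) c (T x) = ∑ j, X c j * φ j x := by
      intro x
      rw [LinearMap.comp_apply, hΨ, T.symm_apply_apply]
    simp only [e1, e2]
    exact hR (X c)

end Eigen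

section Partition
variable {n : ℕ}

lemma box_partition (a : Fin n → ℝ) (s : ℝ) (hs : 0 < s)
    (T : EuclideanSpace ℝ (Fin n) ≃ᵢ EuclideanSpace ℝ (Fin n)) :
    ∃ P : Fin (∏ i, (⌊a i / s⌋₊ + 1)) → Set (EuclideanSpace ℝ (Fin n)),
      IsConvexPartition (T '' {x : EuclideanSpace ℝ (Fin n) | ∀ i, |x i| ≤ a i}) P ∧
      ∀ i, Metric.diam (P i) ≤ Real.sqrt n * (2 * s) := by
  classical
  let J := ∀ i, Fin (⌊a i / s⌋₊ + 1)
  have hcard : Fintype.card J = ∏ i, (⌊a i / s⌋₊ + 1) := by simp [J]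
  let e : Fin (∏ i, (⌊a i / s⌋₊ + 1)) ≃ J := (finCongr hcard.symm).trans (Fintype.equivFin J).symm
  let Q : J → Set (EuclideanSpace ℝ (Fin n)) := fun j =>
    {x | (∀ i, |x i| ≤ a i) ∧ ∀ i, ⌊(x i + a i) / (2 * s)⌋₊ = (j i : ℕ)}
  refine ⟨fun m => T '' Q (e m), ⟨?_, ?_, ?_⟩, ?_⟩
  · intro m
    refine isometry_convex T _ ?_
    have : Q (e m) = {x : EuclideanSpace ℝ (Fin n) | ∀ i, |x i| ≤ a i} ∩
        ⋂ i, {x : EuclideanSpace ℝ (Fin n) |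
          x i ∈ {t : ℝ | ⌊(t + a i) / (2 * s)⌋₊ = (e m i : ℕ)}} := by
      ext x; simp [Q]
    rw [this]
    refine (box_convex a).inter (convex_iInter fun i => coord_convex i _ ?_)
    have hmono : Monotone fun t : ℝ => ⌊(t + a i) / (2 * s)⌋₊ := by
      intro t t' h
      apply Nat.floor_mono
      gcongr
    have : Set.OrdConnected {t : ℝ | ⌊(t + a i) / (2 * s)⌋₊ = (e m i : ℕ)} := by
      refine ⟨fun t ht t' ht' z hz => le_antisymm ?_ ?_⟩
      · exact (hmono hz.2).trans (le_of_eq ht')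
      · exact (le_of_eq ht.symm).trans (hmono hz.1)
    exact this.convex
  · rw [← Set.image_iUnion]
    congr 1
    ext x
    simp only [Set.mem_iUnion]
    constructor
    · intro hx
      have hlt : ∀ i, ⌊(x i + a i) / (2 * s)⌋₊ < ⌊a i / s⌋₊ + 1 := by
        intro i
        refine Nat.lt_succ_of_le (Nat.floor_mono ?_)
        rw [div_le_div_iff₀ (by positivity) hs]
        have := (abs_le.1 (hx i)).2
        nlinarith
      refine ⟨e.symm fun i => ⟨_, hlt i⟩, hx, fun i => ?_⟩
      rw [e.apply_symm_apply]
    · rintro ⟨m, hm⟩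
      exact hm.1
  · intro m m' hm
    have : T '' Q (e m) ∩ T '' Q (e m') = ∅ := by
      rw [← Set.image_inter T.injective]
      rw [Set.image_eq_empty]
      ext x
      simp only [Set.mem_inter_iff, Set.mem_empty_iff_false, iff_false, not_and]
      intro h1 h2
      apply hm
      apply e.injective
      funext i
      exact Fin.ext ((h1.2 i).symm.trans (h2.2 i))
    rw [this, measure_empty]
  · intro m
    rw [T.isometry.diam_image]
    refine Metric.diam_le_of_forall_dist_le (by positivity) fun x hx y hy => ?_
    rw [EuclideanSpace.dist_eq]
    have h1 : ∀ i, dist (x i) (y i) ≤ 2 * s := by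
      intro i
      have hx0 : 0 ≤ (x i + a i) / (2 * s) :=
        div_nonneg (by linarith [(abs_le.1 (hx.1 i)).1]) (by positivity)
      have hy0 : 0 ≤ (y i + a i) / (2 * s) :=
        div_nonneg (by linarith [(abs_le.1 (hy.1 i)).1]) (by positivity)
      have a1 := Nat.floor_le hx0
      have a2 := Nat.lt_floor_add_one ((x i + a i) / (2 * s))
      have b1 := Nat.floor_le hy0
      have b2 := Nat.lt_floor_add_one ((y i + a i) / (2 * s))
      rw [hx.2 i] at a1 a2
      rw [hy.2 i] at b1 b2
      rw [le_div_iff₀ (by positivity)] at a1 b1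
      rw [div_lt_iff₀ (by positivity)] at a2 b2
      rw [Real.dist_eq, abs_le]
      constructor <;> linarith
    calc Real.sqrt (∑ i, dist (x i) (y i) ^ 2) ≤ Real.sqrt (∑ _i : Fin n, (2 * s) ^ 2) := by
          gcongr with i
          exact h1 i
      _ = Real.sqrt n * (2 * s) := by
          simp only [Finset.sum_const, Finset.card_univ, Fintype.card_fin, nsmul_eq_mul]
          rw [Real.sqrt_mul (by positivity), Real.sqrt_sq (by positivity)]

lemma exists_scale (hn : 1 ≤ n) (a : Fin n → ℝ) (ha : ∀ i, 0 < a i) (l : ℕ) (hl : 1 ≤ l) :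
    ∃ r : ℝ, 0 < r ∧ l < ∏ i, max 1 ⌊2 * a i / r⌋₊ ∧ ∏ i, max 1 ⌊a i / r⌋₊ ≤ l := by
  classical
  set R := 2 * ∑ i, a i + 1 with hR
  have hsum : ∀ i, a i ≤ ∑ i, a i := fun i =>
    Finset.single_le_sum (fun j _ => (ha j).le) (Finset.mem_univ i)
  have hR0 : 0 < R := by
    have : 0 ≤ ∑ i, a i := Finset.sum_nonneg fun j _ => (ha j).le
    linarith
  have hex : ∃ m : ℕ, l < ∏ i, max 1 ⌊2 * a i / (R / 2 ^ m)⌋₊ := by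
    let i0 : Fin n := ⟨0, hn⟩
    obtain ⟨m, hm⟩ := pow_unbounded_of_one_lt (((l : ℝ) + 1) * R / (2 * a i0)) (one_lt_two)
    refine ⟨m, ?_⟩
    have h1 : max 1 ⌊2 * a i0 / (R / 2 ^ m)⌋₊ ≤ ∏ i, max 1 ⌊2 * a i / (R / 2 ^ m)⌋₊ :=
      Finset.single_le_prod' (f := fun i => max 1 ⌊2 * a i / (R / 2 ^ m)⌋₊)
        (fun i _ => le_max_left _ _) (Finset.mem_univ i0)
    refine lt_of_lt_of_le ?_ h1
    refine lt_of_lt_of_le (Nat.lt_succ_self l) (le_max_of_le_right ?_)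
    apply Nat.le_floor
    rw [div_lt_iff₀ (by linarith [ha i0])] at hm
    rw [le_div_iff₀ (by positivity)]
    push_cast
    rw [← mul_div_assoc, div_le_iff₀ (by positivity)]
    linarith
  have hm := Nat.find_spec hex
  set m := Nat.find hex with hmdef
  refine ⟨R / 2 ^ m, by positivity, hm, ?_⟩
  have hm0 : m ≠ 0 := by
    intro h
    rw [h] at hm
    have : ∏ i, max 1 ⌊2 * a i / (R / 2 ^ 0)⌋₊ = 1 := by
      refine Finset.prod_eq_one fun i _ => max_eq_left ?_
      have : ⌊2 * a i / (R / 2 ^ 0)⌋₊ = 0 := by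
        rw [Nat.floor_eq_zero, pow_zero, div_one, div_lt_one hR0]
        linarith [hsum i]
      omega
    omega
  have h2 := Nat.find_min hex (m := m - 1) (by omega)
  push Not at h2
  refine le_of_eq_of_le (Finset.prod_congr rfl fun i _ => ?_) h2
  have e : a i / (R / 2 ^ m) = 2 * a i / (R / 2 ^ (m - 1)) := by
    obtain ⟨p, hp⟩ := Nat.exists_eq_succ_of_ne_zero hm0
    rw [hp]
    simp only [Nat.succ_eq_add_one, Nat.add_sub_cancel, pow_succ]
    field_simp
  rw [e]

lemma count_le (a : Fin n → ℝ) (hn : 1 ≤ n) (ha : ∀ i, 0 < a i) (r : ℝ) (hr : 0 < r) (k l : ℕ) (hl : 1 ≤ l)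
    (hlk : l ≤ k) (h : ∏ i, max 1 ⌊a i / r⌋₊ ≤ l) :
    ∏ i, (⌊a i / (4 * r * ((l : ℝ) / k) ^ ((1 : ℝ) / n))⌋₊ + 1) ≤ k := by
  set θ := ((l : ℝ) / k) ^ ((1 : ℝ) / n) with hθ
  have hl0 : (0 : ℝ) < l := by exact_mod_cast hl
  have hk0 : (0 : ℝ) < k := by exact_mod_cast (hl.trans hlk)
  have hθ0 : 0 < θ := by positivity
  have hθ1 : θ ≤ 1 := Real.rpow_le_one (by positivity)
    ((div_le_one hk0).2 (by exact_mod_cast hlk)) (by positivity)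
  have hθn : θ ^ n = l / k := by
    rw [hθ, ← Real.rpow_natCast, ← Real.rpow_mul (by positivity)]
    rw [one_div_mul_cancel (by positivity), Real.rpow_one]
  have hone : ∀ i, θ * ((⌊a i / (4 * r * θ)⌋₊ : ℝ) + 1) ≤ ((max 1 ⌊a i / r⌋₊ : ℕ) : ℝ) := by
    intro i
    have hM1 : (1 : ℝ) ≤ ((max 1 ⌊a i / r⌋₊ : ℕ) : ℝ) := by exact_mod_cast le_max_left _ _
    have hMf : (⌊a i / r⌋₊ : ℝ) ≤ ((max 1 ⌊a i / r⌋₊ : ℕ) : ℝ) := by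
      exact_mod_cast le_max_right _ _
    have hlt := Nat.lt_floor_add_one (a i / r)
    have hfl := Nat.floor_le (a := a i / (4 * r * θ))
      (div_nonneg (ha i).le (by positivity))
    have e : θ * (a i / (4 * r * θ)) = a i / r / 4 := by field_simp
    have := mul_le_mul_of_nonneg_left hfl hθ0.le
    rw [e] at this
    by_cases hf : ⌊a i / (4 * r * θ)⌋₊ = 0
    · rw [hf]; simp only [Nat.cast_zero, zero_add, mul_one]; linarith
    · have : (1 : ℝ) ≤ ⌊a i / (4 * r * θ)⌋₊ := by exact_mod_cast Nat.one_le_iff_ne_zero.2 hf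
      nlinarith
  have hprod : θ ^ n * ∏ i, ((⌊a i / (4 * r * θ)⌋₊ : ℝ) + 1) ≤ l := by
    calc θ ^ n * ∏ i, ((⌊a i / (4 * r * θ)⌋₊ : ℝ) + 1)
        = ∏ i, θ * ((⌊a i / (4 * r * θ)⌋₊ : ℝ) + 1) := by
          rw [Finset.prod_mul_distrib]; simp
      _ ≤ ∏ i, ((max 1 ⌊a i / r⌋₊ : ℕ) : ℝ) :=
          Finset.prod_le_prod (fun i _ => by positivity) fun i _ => hone i
      _ ≤ l := by exact_mod_cast h
  rw [hθn] at hprod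
  have : ∏ i, ((⌊a i / (4 * r * θ)⌋₊ : ℝ) + 1) ≤ k := by
    rw [div_mul_eq_mul_div, div_le_iff₀ hk0] at hprod
    exact le_of_mul_le_mul_left hprod hl0
  exact_mod_cast this

end Partition

/-- Second partition lemma: there is a universal constant `c > 0` such that for every
`n ≥ 1`, every orthotope `Ω ⊆ ℝⁿ`, and all integers `k ≥ l ≥ 1`, there is a convex
partition of `Ω` into `k' ≤ k` pieces, each of diameter at most
`c · n^(3/2) · (l/k)^(1/n) / √(μ_l(Ω))`. -/
theorem partition_lemma_two :
    ∃ c : ℝ, 0 < c ∧ ∀ n : ℕ, 1 ≤ n →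
      ∀ Ω : Set (EuclideanSpace ℝ (Fin n)), IsOrthotope n Ω →
        ∀ k l : ℕ, 1 ≤ l → l ≤ k →
          ∃ (k' : ℕ) (P : Fin k' → Set (EuclideanSpace ℝ (Fin n))),
            k' ≤ k ∧ IsConvexPartition Ω P ∧
            ∀ i, Metric.diam (P i) ≤
              c * (n : ℝ) ^ ((3 : ℝ) / 2) * ((l : ℝ) / (k : ℝ)) ^ ((1 : ℝ) / (n : ℝ)) /
                Real.sqrt (neumannEigenvalue n l Ω) := by
  obtain ⟨C, hC, hbump⟩ := bump_one_dim
  refine ⟨8 * Real.sqrt C, by positivity, ?_⟩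
  rintro n hn Ω ⟨T, a, ha, rfl⟩ k l hl hlk
  obtain ⟨r, hr, hlt, hle⟩ := exists_scale hn a ha l hl
  set B := {x : EuclideanSpace ℝ (Fin n) | ∀ i, |x i| ≤ a i} with hB
  obtain ⟨V, hV, hVR⟩ := test_space C r a (fun i => max 1 ⌊2 * a i / r⌋₊)
    (fun i => hbump (a i) r (ha i) hr) l hlt T
  have hup : neumannEigenvalue n l (T '' B) ≤ n * (C / r ^ 2) :=
    eigen_le l _ _ (by positivity) V hV hVR
  have hpos : 0 < neumannEigenvalue n l (T '' B) := by
    refine eigen_pos l hl _ ((box_compact a).image T.continuous)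
      (isometry_convex T _ (box_convex a)) ?_ ⟨V, hV⟩
    have := T.toHomeomorph.image_interior B
    have h2 := (box_interior a ha).image T
    rw [← hB] at h2
    have h3 : T '' interior B = interior (T '' B) := this
    rwa [h3] at h2
  set μ := neumannEigenvalue n l (T '' B) with hμ
  set θ := ((l : ℝ) / k) ^ ((1 : ℝ) / n) with hθ
  have hl0 : (0 : ℝ) < l := by exact_mod_cast hl
  have hk0 : (0 : ℝ) < k := by exact_mod_cast (hl.trans hlk)
  have hθ0 : 0 < θ := by positivity
  have hn1 : (1 : ℝ) ≤ n := by exact_mod_cast hn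
  obtain ⟨P, hP, hPd⟩ := box_partition a (4 * r * θ) (by positivity) T
  refine ⟨_, P, count_le a hn ha r hr k l hl hlk hle, hP, fun i => (hPd i).trans ?_⟩
  have hsμ : 0 < Real.sqrt μ := Real.sqrt_pos.2 hpos
  rw [le_div_iff₀ hsμ]
  have h1 : Real.sqrt μ ≤ Real.sqrt n * (Real.sqrt C / r) := by
    refine (Real.sqrt_le_sqrt hup).trans (le_of_eq ?_)
    rw [Real.sqrt_mul (by positivity), Real.sqrt_div hC.le, Real.sqrt_sq hr.le]
  have h2 : (n : ℝ) ≤ (n : ℝ) ^ ((3 : ℝ) / 2) := by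
    conv_lhs => rw [← Real.rpow_one (n : ℝ)]
    exact Real.rpow_le_rpow_of_exponent_le hn1 (by norm_num)
  have h3 : Real.sqrt n * Real.sqrt n = n := Real.mul_self_sqrt (by positivity)
  calc Real.sqrt n * (2 * (4 * r * θ)) * Real.sqrt μ
      ≤ Real.sqrt n * (2 * (4 * r * θ)) * (Real.sqrt n * (Real.sqrt C / r)) := by gcongr
    _ = 8 * Real.sqrt C * (Real.sqrt n * Real.sqrt n) * θ := by field_simp; ring
    _ = 8 * Real.sqrt C * n * θ := by rw [h3]
    _ ≤ 8 * Real.sqrt C * (n : ℝ) ^ ((3 : ℝ) / 2) * θ := by gcongr
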